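/- arXiv:2006.08958 — 2 statements merged into one kernel-verified Lean document; each statement's English description precedes it below -/
import Mathlib

section
/- Let f be a Boolean formula in conjunctive normal form over variables x_1, …, x_n with clauses c_1, …, c_m, where each clause is a nonempty finite set of literals (a literal is a variable x_k or its negation ¬x_k). Construct a task set 𝒯 with: for each variable x_k, an assignment task X_k and an inverse assignment task X̄_k; for each clause c_i, an inverted clause task C̄_i; and one distinguished task A. The negator relationships 𝒩 are: (X_k, X̄_k) and (X̄_k, X_k) for every k (mutual exclusion of each assignment-task pair); for every clause c_i and every literal ℓ ∈ c_i, a negator from the literal's task (X_k if ℓ = x_k, X̄_k if ℓ = ¬x_k) to C̄_i; and (C̄_i, A) for every i. Then f is satisfiable if and only if there exists a stable task assignment V ⊆ 𝒯 with A ∈ V. (This is the correctness of the reduction from 3-SAT to NEGATOR-SAT underlying the NP-hardness of NEGATOR-SAT.) -/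
/-- The tasks of the NEGATOR-SAT instance constructed from a CNF formula with `n`
variables and `m` clauses: an assignment task `pos k` (i.e. `Xₖ`) and an inverse
assignment task `negv k` (i.e. `X̄ₖ`) for each variable, an inverted clause task
`clause i` (i.e. `C̄ᵢ`) for each clause, and one distinguished task `A`. -/
inductive SatTask (n m : ℕ) : Type
  | pos : Fin n → SatTask n m
  | negv : Fin n → SatTask n m
  | clause : Fin m → SatTask n m
  | A : SatTask n m
  deriving DecidableEq

/-- A clause is a finite set of literals; a literal `(k, b)` is the variable `xₖ`
if `b = true` and its negation `¬xₖ` if `b = false`.  The negator relationships of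
the constructed instance:  `(Xₖ, X̄ₖ)` and `(X̄ₖ, Xₖ)` for every variable,
a negator from each literal's task to the inverted clause task of every clause
containing the literal, and `(C̄ᵢ, A)` for every clause. -/
def NegRel {n m : ℕ} (c : Fin m → Finset (Fin n × Bool)) :
    Set (SatTask n m × SatTask n m) :=
  { p | (∃ k, p = (SatTask.pos k, SatTask.negv k)) ∨
        (∃ k, p = (SatTask.negv k, SatTask.pos k)) ∨
        (∃ i k, (k, true) ∈ c i ∧ p = (SatTask.pos k, SatTask.clause i)) ∨
        (∃ i k, (k, false) ∈ c i ∧ p = (SatTask.negv k, SatTask.clause i)) ∨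
        (∃ i, p = (SatTask.clause i, SatTask.A)) }

/-- A stable task assignment (over the whole finite task type): every non-assigned
task has an inbound negator relationship from an assigned task, and no assigned task
has an inbound negator relationship from an assigned task. -/
def IsStable {α : Type*} (𝒩 : Set (α × α)) (V : Set α) : Prop :=
  (∀ t, t ∉ V → ∃ t' ∈ V, (t', t) ∈ 𝒩) ∧ ∀ t ∈ V, ∀ t' ∈ V, (t', t) ∉ 𝒩

/-- Correctness of the reduction from SAT (in CNF) to NEGATOR-SAT: the CNF formula
with clauses `c i` (each nonempty) is satisfiable iff the constructed instance has a
stable task assignment containing the distinguished task `A`. -/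
theorem cnf_sat_iff_negator_sat {n m : ℕ} (c : Fin m → Finset (Fin n × Bool))
    (hc : ∀ i, (c i).Nonempty) :
    (∃ I : Fin n → Bool, ∀ i, ∃ ℓ ∈ c i, I ℓ.1 = ℓ.2) ↔
      (∃ V : Set (SatTask n m), IsStable (NegRel c) V ∧ SatTask.A ∈ V) := by
  constructor
  · rintro ⟨I, hI⟩
    refine ⟨{t | (∃ k, t = SatTask.pos k ∧ I k = true) ∨
      (∃ k, t = SatTask.negv k ∧ I k = false) ∨ t = SatTask.A}, ⟨?_, ?_⟩, ?_⟩
    · rintro (k | k | i | _) ht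
      · refine ⟨SatTask.negv k, ?_, ?_⟩
        · simpa using ht
        · simp [NegRel]
      · refine ⟨SatTask.pos k, ?_, ?_⟩
        · simpa using ht
        · simp [NegRel]
      · obtain ⟨⟨k, b⟩, hm, hb⟩ := hI i
        cases b
        · exact ⟨SatTask.negv k, by simpa using hb, by simpa [NegRel] using hm⟩
        · exact ⟨SatTask.pos k, by simpa using hb, by simpa [NegRel] using hm⟩
      · simp at ht
    · rintro (k | k | i | _) ht (k' | k' | i' | _) ht' h <;>
        simp [NegRel] at ht ht' h
      · subst h; simp_all
      · subst h; simp_all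
    · simp
  · rintro ⟨V, ⟨h1, h2⟩, hA⟩
    classical
    refine ⟨fun k => decide (SatTask.pos k ∈ V), fun i => ?_⟩
    have hi : SatTask.clause i ∉ V := fun h => h2 _ hA _ h (by simp [NegRel])
    obtain ⟨t', ht', hr⟩ := h1 _ hi
    rcases t' with k | k | j | _ <;> simp [NegRel] at hr
    · exact ⟨(k, true), hr, by simpa using ht'⟩
    · refine ⟨(k, false), hr, ?_⟩
      have : SatTask.pos k ∉ V := fun h => h2 _ h _ ht' (by simp [NegRel])
      simpa using this
end

section
/- Let f be a Boolean formula in conjunctive normal form over variables x_1, …, x_n with clauses c_1, …, c_m, and let (𝒯, 𝒩, A) be the NEGATOR-SAT instance constructed from f (assignment task pairs X_k, X̄_k with mutual negators; inverted clause tasks C̄_i receiving negators from the tasks of the literals of c_i; task A receiving negators from all C̄_i). Then for every stable task assignment V ⊆ 𝒯: (a) for each variable x_k exactly one of X_k, X̄_k lies in V, so V induces a well-defined interpretation I_V with I_V(x_k) = 1 iff X_k ∈ V; (b) for each clause c_i, the task C̄_i lies in V if and only if the interpretation I_V makes every literal of c_i false; and (c) A ∈ V if and only if I_V satisfies f. 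-/
/-- Structure of stable task assignments of the constructed NEGATOR-SAT instance:
(a) for each variable exactly one of `Xₖ`, `X̄ₖ` is assigned, so `V` induces a
well-defined interpretation `I` with `I k = true ↔ Xₖ ∈ V`;
(b) the inverted clause task `C̄ᵢ` is assigned iff `I` makes every literal of the
clause `cᵢ` false;
(c) `A` is assigned iff `I` satisfies the formula. -/
theorem stable_negator_sat_structure {n m : ℕ} (c : Fin m → Finset (Fin n × Bool))
    (hc : ∀ i, (c i).Nonempty) (V : Set (SatTask n m)) (hV : IsStable (NegRel c) V) :
    (∀ k : Fin n, (SatTask.pos k ∈ V ∧ SatTask.negv k ∉ V) ∨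
        (SatTask.pos k ∉ V ∧ SatTask.negv k ∈ V)) ∧
    ∃ I : Fin n → Bool,
      (∀ k : Fin n, I k = true ↔ SatTask.pos k ∈ V) ∧
      (∀ k : Fin n, I k = false ↔ SatTask.negv k ∈ V) ∧
      (∀ i : Fin m, SatTask.clause i ∈ V ↔ ∀ ℓ ∈ c i, I ℓ.1 ≠ ℓ.2) ∧
      (SatTask.A ∈ V ↔ ∀ i : Fin m, ∃ ℓ ∈ c i, I ℓ.1 = ℓ.2) := by
  obtain ⟨h1, h2⟩ := hV
  have hp : ∀ k, SatTask.pos k ∈ V ↔ SatTask.negv k ∉ V := by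
    intro k
    constructor
    · intro h h'
      exact h2 _ h' _ h (Or.inl ⟨k, rfl⟩)
    · intro h
      obtain ⟨t, ht, hr⟩ := h1 _ h
      simp [NegRel] at hr
      rwa [hr] at ht
  have hcl : ∀ i, SatTask.clause i ∈ V ↔
      ((∀ k, (k, true) ∈ c i → SatTask.pos k ∉ V) ∧
        (∀ k, (k, false) ∈ c i → SatTask.negv k ∉ V)) := by
    intro i
    constructor
    · intro h
      exact ⟨fun k hk hv => h2 _ h _ hv (Or.inr (Or.inr (Or.inl ⟨i, k, hk, rfl⟩))),
        fun k hk hv => h2 _ h _ hv (Or.inr (Or.inr (Or.inr (Or.inl ⟨i, k, hk, rfl⟩))))⟩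
    · rintro ⟨ha, hb⟩
      by_contra h
      obtain ⟨t, ht, hr⟩ := h1 _ h
      rcases hr with ⟨k, hr⟩ | ⟨k, hr⟩ | ⟨j, k, hk, hr⟩ | ⟨j, k, hk, hr⟩ | ⟨j, hr⟩ <;>
        simp only [Prod.mk.injEq, reduceCtorEq, and_false, SatTask.clause.injEq] at hr
      · obtain ⟨rfl, rfl⟩ := hr
        exact ha k hk ht
      · obtain ⟨rfl, rfl⟩ := hr
        exact hb k hk ht
  have hA : SatTask.A ∈ V ↔ ∀ i, SatTask.clause i ∉ V := by
    constructor
    · intro h i hi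
      exact h2 _ h _ hi (Or.inr (Or.inr (Or.inr (Or.inr ⟨i, rfl⟩))))
    · intro h
      by_contra h'
      obtain ⟨t, ht, hr⟩ := h1 _ h'
      simp [NegRel] at hr
      obtain ⟨i, rfl⟩ := hr
      exact h i ht
  classical
  have hI : ∀ i : Fin m, SatTask.clause i ∈ V ↔
      ∀ ℓ ∈ c i, (decide (SatTask.pos ℓ.1 ∈ V)) ≠ ℓ.2 := by
    intro i
    rw [hcl]
    constructor
    · rintro ⟨ha, hb⟩ ⟨k, b⟩ hk
      cases b
      · simpa [hp] using hb k hk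
      · simpa using ha k hk
    · intro h
      exact ⟨fun k hk => by simpa using h _ hk, fun k hk => by simpa [hp] using h _ hk⟩
  refine ⟨fun k => ?_, fun k => decide (SatTask.pos k ∈ V), ?_, ?_, hI, ?_⟩
  · have := hp k
    tauto
  · simp
  · intro k
    simp [hp]
  · rw [hA]
    refine forall_congr' fun i => ?_
    rw [hI]
    push Not
    rfl
end
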